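/- Every finite 4-bridged graph with at least two vertices is bi-dismantlable: one can successively remove, at each step, a vertex at maximal distance from a fixed base vertex u (each such vertex being bi-dominated), until only the ball B_1(u), which is a complete bipartite graph, remains. -/

import Mathlib

/-- Distance between `i` and `j` along a cycle of length `n`. -/
def cycleDist (n : ℕ) (i j : ZMod n) : ℕ := min (i - j).val (j - i).val

/-- `f` is an isometrically embedded `n`-cycle in `G`: consecutive vertices are
adjacent and distances in `G` agree with distances along the cycle. -/
def IsIsometricCycle {V : Type*} (G : SimpleGraph V) (n : ℕ) (f : ZMod n → V) : Prop :=
  (∀ i : ZMod n, G.Adj (f i) (f (i + 1))) ∧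
  ∀ i j : ZMod n, G.dist (f i) (f j) = cycleDist n i j

/-- A graph is 4-bridged if every isometrically embedded cycle has length 4. -/
def FourBridged {V : Type*} (G : SimpleGraph V) : Prop :=
  ∀ n : ℕ, 3 ≤ n → ∀ f : ZMod n → V, IsIsometricCycle G n f → n = 4

/-- `v` is bi-dominated by `u` within the induced subgraph on `s`:
every neighbour of `v` in `s` is a neighbour of `u`. -/
def BiDominatedIn {V : Type*} (G : SimpleGraph V) (s : Finset V) (v u : V) : Prop :=
  v ∈ s ∧ u ∈ s ∧ v ≠ u ∧ ∀ x ∈ s, G.Adj v x → G.Adj u x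

/-- The induced subgraph on `s` is a complete bipartite graph (biclique). -/
def IsBiclique {V : Type*} [DecidableEq V] (G : SimpleGraph V) (s : Finset V) : Prop :=
  ∃ A B : Finset V, A.Nonempty ∧ B.Nonempty ∧ Disjoint A B ∧ A ∪ B = s ∧
    ∀ a ∈ s, ∀ b ∈ s, (G.Adj a b ↔ ((a ∈ A ∧ b ∈ B) ∨ (a ∈ B ∧ b ∈ A)))

/-- `s` (as an induced subgraph of `G`) is bi-dismantlable: a biclique can be obtained
by successively deleting bi-dominated vertices. -/
inductive BiDismantlable {V : Type*} [DecidableEq V] (G : SimpleGraph V) : Finset V → Prop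
  | biclique (s : Finset V) : IsBiclique G s → BiDismantlable G s
  | step (s : Finset V) (v u : V) : BiDominatedIn G s v u →
      BiDismantlable G (s.erase v) → BiDismantlable G s


namespace FB

open SimpleGraph

variable {V : Type*} {G : SimpleGraph V}

/-- quadrangle condition at level `h` -/
def QC (G : SimpleGraph V) (h : ℕ) : Prop :=
  ∀ u v x y : V, G.dist u v = h → G.Adj v x → G.Adj v y → G.dist u x + 1 = h →
    G.dist u y + 1 = h → x ≠ y → ∃ e, G.Adj x e ∧ G.Adj y e ∧ G.dist u e + 2 = h

/-- no horizontal edges at level `h` -/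
def Flat (G : SimpleGraph V) (h : ℕ) : Prop :=
  ∀ u a b : V, G.dist u a = h → G.dist u b = h → ¬ G.Adj a b

theorem adj_iff {a b : V} : G.Adj a b ↔ G.dist a b = 1 := SimpleGraph.dist_eq_one_iff_adj.symm

theorem exists_nbr (hc : G.Connected) {u v : V} {k : ℕ} (h : G.dist u v = k + 1) :
    ∃ c, G.Adj v c ∧ G.dist u c = k := by
  obtain ⟨p, hp⟩ := hc.exists_walk_length_eq_dist v u
  cases p with
  | nil => simp at h
  | cons hadj q =>
    rename_i c
    refine ⟨c, hadj, ?_⟩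
    have h1 := SimpleGraph.dist_le q
    have h2 := hc.dist_triangle (u := u) (v := c) (w := v)
    have h3 := adj_iff.1 hadj
    rw [SimpleGraph.Walk.length_cons] at hp
    have := G.dist_comm (u := u) (v := v)
    have := G.dist_comm (u := c) (v := v)
    have := G.dist_comm (u := c) (v := u)
    omega

/-- `p` restricted to `[0,r]` is a geodesic -/
def Geo (G : SimpleGraph V) (r : ℕ) (p : ℕ → V) : Prop :=
  ∀ i j, i ≤ j → j ≤ r → G.dist (p i) (p j) = j - i

theorem geo_cons (hc : G.Connected) {u v x : V} {r : ℕ} {p : ℕ → V} (hp : Geo G r p)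
    (h0 : p 0 = x) (hr : p r = u) (hadj : G.Adj v x) (hd : G.dist u v = r + 1) :
    ∃ q : ℕ → V, q 0 = v ∧ q 1 = x ∧ q (r + 1) = u ∧ Geo G (r + 1) q := by
  refine ⟨fun i => Nat.casesOn i v p, rfl, h0, hr, ?_⟩
  intro i j hij hj
  rcases i with _ | i
  · rcases j with _ | j
    · simp
    · show G.dist v (p j) = j + 1 - 0
      have h1 := hp 0 j (by omega) (by omega)
      have h2 := hp j r (by omega) (by omega)
      rw [h0] at h1
      rw [hr] at h2
      have h3 := hc.dist_triangle (u := v) (v := x) (w := p j)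
      have h4 := hc.dist_triangle (u := v) (v := p j) (w := u)
      have h5 := adj_iff.1 hadj
      have := G.dist_comm (u := u) (v := v)
      omega
  · rcases j with _ | j
    · omega
    · show G.dist (p i) (p j) = j + 1 - (i + 1)
      rw [hp i j (by omega) (by omega)]
      omega

theorem exists_geo (hc : G.Connected) (r : ℕ) : ∀ u v : V, G.dist u v = r →
    ∃ p : ℕ → V, p 0 = v ∧ p r = u ∧ Geo G r p := by
  induction r with
  | zero =>
    intro u v h
    refine ⟨fun _ => v, rfl, ((hc.dist_eq_zero_iff).1 h).symm, ?_⟩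
    intro i j hij hj
    have : j = 0 := by omega
    subst this
    simp
  | succ r ih =>
    intro u v h
    obtain ⟨c, hadj, hcd⟩ := exists_nbr hc h
    obtain ⟨p, h0, hr, hp⟩ := ih u c hcd
    obtain ⟨q, hq0, -, hqr, hq⟩ := geo_cons hc hp h0 hr hadj h
    exact ⟨q, hq0, hqr, hq⟩

theorem cycle_len (hfb : FourBridged G) (n : ℕ) (hn : 3 ≤ n) (f : ℕ → V)
    (hf : ∀ i j, i < j → j < n → G.dist (f i) (f j) = min (j - i) (n - (j - i))) : n = 4 := by
  have : NeZero n := ⟨by omega⟩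
  have key : ∀ i j : ZMod n, G.dist (f i.val) (f j.val) = cycleDist n i j := by
    have lt_case : ∀ i j : ZMod n, i.val < j.val →
        G.dist (f i.val) (f j.val) = cycleDist n i j := by
      intro i j hij
      rw [hf _ _ hij (ZMod.val_lt j)]
      have h1 : (j - i).val = j.val - i.val := ZMod.val_sub hij.le
      have hne : NeZero (j - i) := ⟨by
        intro h
        rw [h, ZMod.val_zero] at h1
        omega⟩
      have h2 : (i - j).val = n - (j - i).val := by
        rw [← neg_sub j i]
        exact ZMod.val_neg_of_ne_zero (j - i)
      unfold cycleDist
      rw [h2, h1, min_comm]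
    intro i j
    rcases lt_trichotomy i.val j.val with h | h | h
    · exact lt_case i j h
    · have : i = j := ZMod.val_injective n h
      subst this
      simp [cycleDist]
    · rw [SimpleGraph.dist_comm, lt_case j i h]
      unfold cycleDist
      rw [min_comm]
  refine hfb n hn (fun z => f z.val) ⟨?_, key⟩
  intro i
  rw [adj_iff, key]
  have : Fact (1 < n) := ⟨by omega⟩
  have h1 : (1 : ZMod n).val = 1 := ZMod.val_one n
  have : NeZero (1 : ZMod n) := ⟨one_ne_zero⟩
  have h2 : (-1 : ZMod n).val = n - 1 := by
    rw [ZMod.val_neg_of_ne_zero, h1]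
  unfold cycleDist
  have e1 : i - (i + 1) = -1 := by ring
  have e2 : i + 1 - i = 1 := by ring
  rw [e1, e2, h1, h2]
  omega

theorem glue (hfb : FourBridged G) (r ε : ℕ) (hn : 3 ≤ 2 * r + ε) (hε : ε ≤ 1)
    (p q : ℕ → V) (hp : Geo G r p) (hq : Geo G r q) (hu : p r = q r)
    (hpq : ∀ i j, i < r → j < r → 1 ≤ j + ε →
      G.dist (p i) (q j) = min (i + j + ε) (2 * r - i - j)) : 2 * r + ε = 4 := by
  refine cycle_len hfb _ hn (fun k => if k ≤ r then p k else q (2 * r - k)) ?_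
  intro i j hij hj
  by_cases hjr : j ≤ r
  · have hir : i ≤ r := by omega
    simp only [hjr, hir, if_true]
    rw [hp i j hij.le hjr]
    omega
  · by_cases hir : i ≤ r
    · simp only [hjr, hir, if_true, if_false]
      rcases hir.lt_or_eq with h | h
      · rw [hpq i (2 * r - j) h (by omega) (by omega)]
        omega
      · subst h
        rw [hu, SimpleGraph.dist_comm, hq _ _ (by omega) le_rfl]
        omega
    · simp only [hjr, hir, if_false]
      rw [SimpleGraph.dist_comm, hq _ _ (by omega) (by omega)]
      omega

theorem median (hc : G.Connected) (u : V) (S : ℕ) (hQ : ∀ h, 2 * h ≤ S → QC G h)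
    (hF : ∀ h, 2 * h + 1 ≤ S → Flat G h) (m : ℕ) :
    ∀ a b : V, G.dist a b = m → G.dist u a + G.dist u b + m ≤ S →
    ∃ w, G.dist u a = G.dist u w + G.dist w a ∧ G.dist u b = G.dist u w + G.dist w b ∧
      G.dist a b = G.dist w a + G.dist w b := by
  induction m with
  | zero =>
    intro a b h _
    have := (hc.dist_eq_zero_iff).1 h
    subst this
    exact ⟨a, by simp⟩
  | succ m ih =>
    intro a b h hS
    obtain ⟨a', hadj, ha'⟩ := exists_nbr hc (u := b) (v := a) (k := m)
      (by rw [SimpleGraph.dist_comm]; exact h)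
    have haa := adj_iff.1 hadj
    have c1 := G.dist_comm (u := a) (v := a')
    have c2 := G.dist_comm (u := b) (v := a')
    have t1 := hc.dist_triangle (u := u) (v := a) (w := a')
    have t2 := hc.dist_triangle (u := u) (v := a') (w := a)
    have t3 := hc.dist_triangle (u := u) (v := b) (w := a')
    have lift : ∀ e, G.Adj a e → G.dist e b = m → G.dist u e + 1 = G.dist u a →
        ∃ w, G.dist u a = G.dist u w + G.dist w a ∧ G.dist u b = G.dist u w + G.dist w b ∧
          G.dist a b = G.dist w a + G.dist w b := by
      intro e hae heb hue
      obtain ⟨w, h1, h2, h3⟩ := ih e b heb (by omega)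
      have := adj_iff.1 hae
      have := G.dist_comm (u := a) (v := e)
      have := hc.dist_triangle (u := w) (v := e) (w := a)
      have := hc.dist_triangle (u := u) (v := w) (w := a)
      exact ⟨w, by omega, by omega, by omega⟩
    rcases Nat.lt_trichotomy (G.dist u a') (G.dist u a) with hlt | heq | hgt
    · exact lift a' hadj (by omega) (by omega)
    · exact absurd hadj (hF (G.dist u a) (by omega) u a a' rfl heq)
    · obtain ⟨w, h1, h2, h3⟩ := ih a' b (by omega) (by omega)
      rcases Nat.eq_zero_or_pos (G.dist w a') with h0 | hpos
      · have := (hc.dist_eq_zero_iff).1 h0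
        subst this
        exact ⟨a, by simp, by omega, by simp⟩
      · obtain ⟨k, hk⟩ : ∃ k, G.dist w a' = k + 1 := ⟨G.dist w a' - 1, by omega⟩
        obtain ⟨c, hca, hcw⟩ := exists_nbr hc hk
        have s1 := adj_iff.1 hca
        have s2 := hc.dist_triangle (u := u) (v := w) (w := c)
        have s3 := hc.dist_triangle (u := u) (v := c) (w := a')
        have s4 := hc.dist_triangle (u := c) (v := w) (w := b)
        have s5 := G.dist_comm (u := c) (v := w)
        have s6 := G.dist_comm (u := c) (v := a')
        have hne : a ≠ c := by
          rintro rfl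
          omega
        obtain ⟨e, he1, he2, he3⟩ := hQ (G.dist u a') (by omega) u a' a c rfl hadj.symm hca
          (by omega) (by omega) hne
        have r1 := adj_iff.1 he1
        have r2 := adj_iff.1 he2
        have r3 := hc.dist_triangle (u := e) (v := c) (w := b)
        have r4 := hc.dist_triangle (u := a) (v := e) (w := b)
        have r5 := G.dist_comm (u := c) (v := e)
        exact lift e he1 (by omega) (by omega)

theorem qc_step (hc : G.Connected) (hfb : FourBridged G) (r : ℕ)
    (hQ : ∀ h < r, QC G h) (hF : ∀ h < r, Flat G h) : QC G r := by
  intro u v x y huv hvx hvy hux huy hxy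
  have ax := adj_iff.1 hvx
  have ay := adj_iff.1 hvy
  obtain ⟨r, rfl⟩ : ∃ k, r = k + 1 := ⟨r - 1, by omega⟩
  obtain ⟨p', h0, hr, hp'⟩ := exists_geo hc r u x (by omega)
  obtain ⟨p, p0, p1, pr, hp⟩ := geo_cons hc hp' h0 hr hvx huv
  obtain ⟨q', h0', hr', hq'⟩ := exists_geo hc r u y (by omega)
  obtain ⟨q, q0, q1, qr, hq⟩ := geo_cons hc hq' h0' hr' hvy huv
  by_contra hno
  have hr0 : r ≠ 0 := by
    rintro rfl
    have e1 := (hc.dist_eq_zero_iff (u := u) (v := x)).1 (by omega)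
    have e2 := (hc.dist_eq_zero_iff (u := u) (v := y)).1 (by omega)
    exact hxy (e1.symm.trans e2)
  have hr1 : r ≠ 1 := by
    rintro rfl
    exact hno ⟨u, (adj_iff.2 (by omega : G.dist u x = 1)).symm,
      (adj_iff.2 (by omega : G.dist u y = 1)).symm, by simp⟩
  have := glue hfb (r + 1) 0 (by omega) (by omega) p q hp hq (by rw [pr, qr]) ?_
  · omega
  intro i j hi hj hj1
  rcases Nat.eq_zero_or_pos i with rfl | hi0
  · rw [p0, ← q0, hq 0 j (by omega) (by omega)]
    omega
  have P0 := hp 0 i (by omega) (by omega)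
  have P1 := hp 1 i (by omega) (by omega)
  have PR := hp i (r+1) (by omega) (by omega)
  have Q0 := hq 0 j (by omega) (by omega)
  have Q1 := hq 1 j (by omega) (by omega)
  have QR := hq j (r+1) (by omega) (by omega)
  rw [p0] at P0
  rw [p1] at P1
  rw [pr] at PR
  rw [q0] at Q0
  rw [q1] at Q1
  rw [qr] at QR
  have t1 := hc.dist_triangle (u := p i) (v := v) (w := q j)
  have t2 := hc.dist_triangle (u := p i) (v := u) (w := q j)
  have c1 := G.dist_comm (u := p i) (v := v)
  have c2 := G.dist_comm (u := q j) (v := u)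
  have c3 := G.dist_comm (u := p i) (v := u)
  by_cases hm : G.dist (p i) (q j) = i + j
  · omega
  obtain ⟨w, w1, w2, w3⟩ := median hc u (2 * r + 1) (fun h hh => hQ h (by omega))
    (fun h hh => hF h (by omega)) _ (p i) (q j) rfl (by omega)
  rcases Nat.eq_zero_or_pos (G.dist u w) with hw | hw
  · omega
  exfalso
  have s1 := hc.dist_triangle (u := w) (v := p i) (w := x)
  have s2 := hc.dist_triangle (u := u) (v := w) (w := x)
  have s3 := hc.dist_triangle (u := w) (v := q j) (w := y)
  have s4 := hc.dist_triangle (u := u) (v := w) (w := y)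
  have s5 := hc.dist_triangle (u := w) (v := x) (w := v)
  have s6 := hc.dist_triangle (u := u) (v := w) (w := v)
  have c4 := G.dist_comm (u := p i) (v := x)
  have c5 := G.dist_comm (u := q j) (v := y)
  have c6 := G.dist_comm (u := x) (v := v)
  obtain ⟨e, he1, he2, he3⟩ := hQ (G.dist w v) (by omega) w v x y rfl hvx hvy
    (by omega) (by omega) hxy
  have r1 := adj_iff.1 he1
  have r2 := hc.dist_triangle (u := u) (v := w) (w := e)
  have r3 := hc.dist_triangle (u := u) (v := e) (w := x)
  have c7 := G.dist_comm (u := x) (v := e)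
  exact hno ⟨e, he1, he2, by omega⟩

theorem flat_step (hc : G.Connected) (hfb : FourBridged G) (r : ℕ)
    (hQ : ∀ h ≤ r, QC G h) (hF : ∀ h < r, Flat G h) : Flat G r := by
  intro u a b hua hub hab
  have aab := adj_iff.1 hab
  obtain ⟨p, p0, pr, hp⟩ := exists_geo hc r u a hua
  obtain ⟨q, q0, qr, hq⟩ := exists_geo hc r u b hub
  have hr0 : r ≠ 0 := by
    rintro rfl
    have e1 := (hc.dist_eq_zero_iff (u := u) (v := a)).1 hua
    have e2 := (hc.dist_eq_zero_iff (u := u) (v := b)).1 hub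
    exact hab.ne (e1.symm.trans e2)
  have := glue hfb r 1 (by omega) (by omega) p q hp hq (by rw [pr, qr]) ?_
  · omega
  intro i j hi hj hj1
  have P0 := hp 0 i (by omega) (by omega)
  have PR := hp i r (by omega) (by omega)
  have Q0 := hq 0 j (by omega) (by omega)
  have QR := hq j r (by omega) (by omega)
  rw [p0] at P0
  rw [pr] at PR
  rw [q0] at Q0
  rw [qr] at QR
  have t1 := hc.dist_triangle (u := p i) (v := a) (w := q j)
  have t1' := hc.dist_triangle (u := a) (v := b) (w := q j)
  have t2 := hc.dist_triangle (u := p i) (v := u) (w := q j)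
  have c1 := G.dist_comm (u := p i) (v := a)
  have c2 := G.dist_comm (u := q j) (v := u)
  have c3 := G.dist_comm (u := p i) (v := u)
  by_cases hm : G.dist (p i) (q j) = i + j + 1
  · omega
  obtain ⟨w, w1, w2, w3⟩ := median hc u (2 * r) (fun h hh => hQ h (by omega))
    (fun h hh => hF h (by omega)) _ (p i) (q j) rfl (by omega)
  rcases Nat.eq_zero_or_pos (G.dist u w) with hw | hw
  · omega
  exfalso
  have s1 := hc.dist_triangle (u := w) (v := p i) (w := a)
  have s2 := hc.dist_triangle (u := u) (v := w) (w := a)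
  have s3 := hc.dist_triangle (u := w) (v := q j) (w := b)
  have s4 := hc.dist_triangle (u := u) (v := w) (w := b)
  have c5 := G.dist_comm (u := q j) (v := b)
  exact hF (G.dist w a) (by omega) w a b rfl (by omega) hab

theorem all (hc : G.Connected) (hfb : FourBridged G) (r : ℕ) : QC G r ∧ Flat G r := by
  induction r using Nat.strong_induction_on with
  | _ r ih =>
    have h1 := qc_step hc hfb r (fun h hh => (ih h hh).1) (fun h hh => (ih h hh).2)
    refine ⟨h1, flat_step hc hfb r (fun h hh => ?_) (fun h hh => (ih h hh).2)⟩
    rcases hh.lt_or_eq with h' | h'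
    · exact (ih h h').1
    · exact h' ▸ h1

theorem even_dist (hc : G.Connected) (hfb : FourBridged G) {a b c : V} (h : G.Adj b c) :
    G.dist a b = G.dist a c + 1 ∨ G.dist a c = G.dist a b + 1 := by
  have h1 := (all hc hfb (G.dist a b)).2 a b c rfl
  have h2 := adj_iff.1 h
  have h3 := hc.dist_triangle (u := a) (v := b) (w := c)
  have h4 := hc.dist_triangle (u := a) (v := c) (w := b)
  have h5 := G.dist_comm (u := b) (v := c)
  have h6 : G.dist a b ≠ G.dist a c := fun e => h1 e.symm h
  omega

/-- no isometric 6-cycles -/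
theorem six (hc : G.Connected) (hfb : FourBridged G) {x1 y1 x2 y2 x3 y3 : V}
    (h1 : G.Adj x1 y1) (h2 : G.Adj y1 x2) (h3 : G.Adj x2 y2) (h4 : G.Adj y2 x3)
    (h5 : G.Adj x3 y3) (h6 : G.Adj y3 x1)
    (n1 : ¬ G.Adj y1 x3) (n2 : ¬ G.Adj y2 x1) : G.Adj y3 x2 := by
  by_contra n3
  have E := fun (a b c : V) (h : G.Adj b c) => even_dist hc hfb (a := a) h
  have step : ∀ {a b c : V}, G.Adj a b → G.Adj b c → a ≠ c → G.dist a c = 2 := by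
    intro a b c hab hbc hne
    have := E a b c hbc
    have := adj_iff.1 hab
    have h0 : G.dist a c ≠ 0 := fun h => hne (hc.dist_eq_zero_iff.1 h)
    omega
  have step3 : ∀ {a b c d : V}, G.dist a c = 2 → G.Adj c d → ¬ G.Adj a d → G.dist a d = 3 := by
    intro a b c d hac hcd hn
    have := E a c d hcd
    have : G.dist a d ≠ 1 := fun h => hn (adj_iff.2 h)
    omega
  have x12 : x1 ≠ x2 := by rintro rfl; exact n3 h6
  have y12 : y1 ≠ y2 := by rintro rfl; exact n1 h4
  have x23 : x2 ≠ x3 := by rintro rfl; exact n1 h2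
  have y23 : y2 ≠ y3 := by rintro rfl; exact n2 h6
  have x13 : x1 ≠ x3 := by rintro rfl; exact n2 h4
  have y13 : y1 ≠ y3 := by rintro rfl; exact n3 h2
  have d01 := adj_iff.1 h1
  have d12 := adj_iff.1 h2
  have d23 := adj_iff.1 h3
  have d34 := adj_iff.1 h4
  have d45 := adj_iff.1 h5
  have d05 := adj_iff.1 h6.symm
  have d02 := step h1 h2 x12
  have d13 := step h2 h3 y12
  have d24 := step h3 h4 x23
  have d35 := step h4 h5 y23
  have d04 := step h6.symm h5.symm x13
  have d15 := step h1.symm h6.symm y13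
  have d03 : G.dist x1 y2 = 3 := step3 (b := x1) d02 h3 (fun h => n2 h.symm)
  have d14 : G.dist y1 x3 = 3 := step3 (b := x1) d13 h4 n1
  have d25 : G.dist x2 y3 = 3 := step3 (b := x1) d24 h5 (fun h => n3 h.symm)
  have := cycle_len hfb 6 (by omega)
    (fun k => match k with
      | 0 => x1 | 1 => y1 | 2 => x2 | 3 => y2 | 4 => x3 | _ => y3) ?_
  · omega
  intro i j hij hj
  interval_cases j <;> interval_cases i <;> simp_all

theorem helly [Fintype V] (hc : G.Connected) (hfb : FourBridged G) (u v : V)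
    (hr : 2 ≤ G.dist u v) :
    ∃ y, G.dist u y + 2 = G.dist u v ∧
      ∀ x, G.Adj v x → G.dist u x + 1 = G.dist u v → G.Adj y x := by
  classical
  let X : Finset V := Finset.univ.filter fun x => G.Adj v x ∧ G.dist u x + 1 = G.dist u v
  let Y : Finset V := Finset.univ.filter fun y => G.dist u y + 2 = G.dist u v
  have hQ : ∀ x ∈ X, ∀ x' ∈ X, x ≠ x' → ∃ y ∈ Y, G.Adj y x ∧ G.Adj y x' := by
    intro x hx x' hx' hne
    simp only [X, Finset.mem_filter, Finset.mem_univ, true_and] at hx hx'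
    obtain ⟨e, h1, h2, h3⟩ := (all hc hfb _).1 u v x x' rfl hx.1 hx'.1 hx.2 hx'.2 hne
    exact ⟨e, by simpa [Y] using h3, h1.symm, h2.symm⟩
  have hX : ∃ x, x ∈ X := by
    obtain ⟨k, hk⟩ : ∃ k, G.dist u v = k + 1 := ⟨G.dist u v - 1, by omega⟩
    obtain ⟨c, h1, h2⟩ := exists_nbr hc hk
    exact ⟨c, by simp only [X, Finset.mem_filter, Finset.mem_univ, true_and]; exact ⟨h1, by omega⟩⟩
  have hdown : ∀ x ∈ X, ∃ y ∈ Y, G.Adj y x := by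
    intro x hx
    simp only [X, Finset.mem_filter, Finset.mem_univ, true_and] at hx
    obtain ⟨k, hk⟩ : ∃ k, G.dist u x = k + 1 := ⟨G.dist u x - 1, by omega⟩
    obtain ⟨c, h1, h2⟩ := exists_nbr hc hk
    exact ⟨c, by simp only [Y, Finset.mem_filter, Finset.mem_univ, true_and]; omega, h1.symm⟩
  obtain ⟨x0, hx0⟩ := hX
  obtain ⟨y0, hy0, hyx0⟩ := hdown x0 hx0
  obtain ⟨y, hyY, hymax⟩ := Finset.exists_max_image Y
    (fun y => (X.filter fun x => G.Adj y x).card) ⟨y0, hy0⟩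
  refine ⟨y, by simpa [Y] using hyY, ?_⟩
  intro x' hx1 hx2
  have hx' : x' ∈ X := by simp [X, hx1, hx2]
  by_contra hn
  let A := X.filter fun x => G.Adj y x
  have hA : A.Nonempty := by
    by_contra hne
    rw [Finset.not_nonempty_iff_eq_empty] at hne
    have h1 := hymax y0 hy0
    have h2 : 0 < (X.filter fun x => G.Adj y0 x).card :=
      Finset.card_pos.2 ⟨x0, by simp [hx0, hyx0]⟩
    have h3 : (X.filter fun x => G.Adj y x).card = 0 := by
      rw [Finset.card_eq_zero]; exact hne
    omega
  obtain ⟨a0, ha0⟩ := hA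
  have hAX : ∀ a ∈ A, a ∈ X ∧ G.Adj y a := fun a ha => by simpa [A] using ha
  have hAne : ∀ a ∈ A, a ≠ x' := by
    rintro a ha rfl
    exact hn (hAX a ha).2
  obtain ⟨z0, hz0, hz0a, hz0x⟩ := hQ a0 (hAX a0 ha0).1 x' hx' (hAne a0 ha0)
  obtain ⟨z, hz, hzmax⟩ := Finset.exists_max_image (Y.filter fun z => G.Adj z x')
    (fun z => (A.filter fun x => G.Adj z x).card) ⟨z0, by simp [hz0, hz0x]⟩
  rw [Finset.mem_filter] at hz
  by_cases hall : ∀ a ∈ A, G.Adj z a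
  · have h1 := hymax z hz.1
    have h2 : A ⊂ X.filter fun x => G.Adj z x := by
      refine Finset.ssubset_iff_subset_ne.2 ⟨?_, ?_⟩
      · intro a ha
        simp [(hAX a ha).1, hall a ha]
      · intro h
        have : x' ∈ A := by rw [h]; simp [hx', hz.2]
        exact hAne x' this rfl
    have := Finset.card_lt_card h2
    simp only [A] at this
    omega
  · push Not at hall
    obtain ⟨a, ha, hza⟩ := hall
    obtain ⟨t, ht, hta, htx⟩ := hQ a (hAX a ha).1 x' hx' (hAne a ha)
    have h1 := hzmax t (by simp [ht, htx])
    have h2 : (A.filter fun x => G.Adj z x) ⊂ A.filter fun x => G.Adj t x := by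
      refine Finset.ssubset_iff_subset_ne.2 ⟨?_, ?_⟩
      · intro b hb
        rw [Finset.mem_filter] at hb ⊢
        exact ⟨hb.1, six hc hfb (hAX a ha).2.symm (hAX b hb.1).2 hb.2.symm hz.2 htx.symm hta
          hn hza⟩
      · intro h
        have : a ∈ A.filter fun x => G.Adj z x := by rw [h]; simp [ha, hta]
        exact hza (Finset.mem_filter.1 this).2
    have := Finset.card_lt_card h2
    omega

theorem dismantle [Fintype V] [DecidableEq V] (hc : G.Connected) (hfb : FourBridged G) (u : V)
    (hu : ∃ c, G.Adj u c) (n : ℕ) :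
    ∀ s : Finset V, s.card = n → (∀ w, G.dist u w ≤ 1 → w ∈ s) →
      (∀ v ∈ s, ∀ w, G.dist u w < G.dist u v → w ∈ s) → BiDismantlable G s := by
  induction n with
  | zero =>
    intro s hs h1 _
    have := h1 u (by simp)
    rw [Finset.card_eq_zero.1 hs] at this
    simp at this
  | succ n ih =>
    intro s hs hball hdown
    obtain ⟨v, hv, hmax⟩ := Finset.exists_max_image s (fun v => G.dist u v)
      ⟨u, hball u (by simp)⟩
    by_cases h2 : 2 ≤ G.dist u v
    · obtain ⟨y, hy1, hy2⟩ := helly hc hfb u v h2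
      refine BiDismantlable.step s v y ⟨hv, hdown v hv y (by omega), ?_, ?_⟩ ?_
      · rintro rfl
        omega
      · intro x hx hvx
        have := hmax x hx
        have := even_dist hc hfb (a := u) hvx
        exact hy2 x hvx (by omega)
      · refine ih _ (by rw [Finset.card_erase_of_mem hv, hs]; rfl) ?_ ?_
        · intro w hw
          refine Finset.mem_erase.2 ⟨?_, hball w hw⟩
          rintro rfl
          omega
        · intro v' hv' w hw
          have hv's := (Finset.mem_erase.1 hv').2
          refine Finset.mem_erase.2 ⟨?_, hdown v' hv's w hw⟩
          rintro rfl
          have := hmax v' hv's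
          omega
    · have hs1 : ∀ w ∈ s, w = u ∨ G.Adj u w := by
        intro w hw
        have := hmax w hw
        rcases Nat.eq_zero_or_pos (G.dist u w) with h | h
        · exact Or.inl (hc.dist_eq_zero_iff.1 h).symm
        · exact Or.inr (adj_iff.2 (by omega))
      have hus : u ∈ s := hball u (by simp)
      refine BiDismantlable.biclique s ⟨{u}, s.erase u, by simp, ?_, by simp, ?_, ?_⟩
      · obtain ⟨c, hcu⟩ := hu
        exact ⟨c, Finset.mem_erase.2 ⟨hcu.ne', hball c (adj_iff.1 hcu).le⟩⟩
      · ext x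
        by_cases h : x = u <;> simp [h, hus]
      · intro a ha b hb
        simp only [Finset.mem_singleton, Finset.mem_erase]
        constructor
        · intro hab
          rcases hs1 a ha with rfl | h1
          · exact Or.inl ⟨rfl, hab.ne', hb⟩
          · rcases hs1 b hb with rfl | h3
            · exact Or.inr ⟨⟨hab.ne, ha⟩, rfl⟩
            · exact absurd hab ((all hc hfb 1).2 u a b (adj_iff.1 h1) (adj_iff.1 h3))
        · rintro (⟨rfl, h1, h3⟩ | ⟨⟨h1, h3⟩, rfl⟩)
          · exact (hs1 b h3).resolve_left h1
          · exact ((hs1 a h3).resolve_left h1).symm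

end FB

/-- Every finite connected 4-bridged graph with at least two vertices is
bi-dismantlable. -/
theorem fourBridged_biDismantlable {V : Type*} [Fintype V] [DecidableEq V]
    (G : SimpleGraph V) (hconn : G.Connected) (hfb : FourBridged G)
    (hcard : 2 ≤ Fintype.card V) :
    BiDismantlable G Finset.univ := by
  obtain ⟨u, w, huw⟩ := Fintype.exists_pair_of_one_lt_card (by omega : 1 < Fintype.card V)
  have h0 : G.dist w u ≠ 0 := fun h => huw (hconn.dist_eq_zero_iff.1 h).symm
  obtain ⟨k, hk⟩ : ∃ k, G.dist w u = k + 1 := ⟨G.dist w u - 1, by omega⟩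
  obtain ⟨c, hc, -⟩ := FB.exists_nbr hconn hk
  exact FB.dismantle hconn hfb u ⟨c, hc⟩ _ Finset.univ rfl (fun _ _ => Finset.mem_univ _)
    (fun _ _ _ _ => Finset.mem_univ _)
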